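/- Let $\mu_1,\mu_2,\nu_1,\nu_2$ be positive integers with $\mu_1+\mu_2=\nu_1+\nu_2=d$, and suppose $\nu_1<\mu_1$, $\nu_2<\mu_1$, $\mu_2<\nu_1$, $\mu_2<\nu_2$. For a transposition $\tau=(a\ b)\in S_d$ with $a<b$ write $\mathrm{top}(\tau)=b$, and let $\sigma_{(\mu_1,\mu_2)}=(1\ \cdots\ \mu_1)(\mu_1+1\ \cdots\ \mu_1+\mu_2)\in S_d$. Let $M_{2,0,0;(\mu_1,\mu_2),(\nu_1,\nu_2)}$ be the number of tuples $(\tau_1,\tau_2,\sigma_2,(B_1,B_2))$ such that $\tau_1,\tau_2\in S_d$ are transpositions with $\mathrm{top}(\tau_1)\le\mathrm{top}(\tau_2)$, $\sigma_2\in S_d$ satisfies $\sigma_2\,\tau_2\,\tau_1\,\sigma_{(\mu_1,\mu_2)}=\mathrm{id}$, the subgroup generated by $\sigma_{(\mu_1,\mu_2)},\tau_1,\tau_2,\sigma_2$ acts transitively on $\{1,\dots,d\}$, and $(B_1,B_2)$ is an ordered list of the orbits of $\sigma_2$ on $\{1,\dots,d\}$ with $|B_1|=\nu_1$ and $|B_2|=\nu_2$.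 Then $$M_{2,0,0;(\mu_1,\mu_2),(\nu_1,\nu_2)}=\mu_1\,\mu_2\,(\mu_1+1).$$ -/

import Mathlib

/-- The larger moved point of a transposition: the largest value in its support.
(The elements of `{1,…,d}` are represented, shifted by one, by `Fin d`.) -/
def permTop {d : ℕ} (τ : Equiv.Perm (Fin d)) : ℕ := τ.support.sup Fin.val

/-- The `(p,q)`-monotonicity condition on a tuple `(τ₁,…,τ_b)` of transpositions
(indexed here by `Fin b`, with index `i` corresponding to `τ_{i+1}`):
`top τ_k ≤ top τ_{k+1}` for `1 ≤ k ≤ p-1` and `top τ_k < top τ_{k+1}` for `p ≤ k ≤ p+q-1`. -/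
def MonCond {d b : ℕ} (p q : ℕ) (τ : Fin b → Equiv.Perm (Fin d)) : Prop :=
  ∀ i j : Fin b, (j : ℕ) = (i : ℕ) + 1 →
    ((i : ℕ) + 1 < p → permTop (τ i) ≤ permTop (τ j)) ∧
    (p ≤ (i : ℕ) + 1 → (i : ℕ) + 1 < p + q → permTop (τ i) < permTop (τ j))

/-- The permutation `σ_μ = (1 … μ₁)(μ₁+1 … μ₁+μ₂)⋯` of `{1,…,d}`, `d = μ₁ + ⋯ + μ_m`, whose
cycles are the consecutive blocks: under the lexicographic identification of
`Σ i, Fin (μ i)` with `Fin d`, it rotates each block, `k ↦ k + 1` modulo the block length. -/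
def blockPerm {m : ℕ} (μ : Fin m → ℕ) : Equiv.Perm (Fin (∑ i, μ i)) :=
  finSigmaFinEquiv.permCongr (Equiv.sigmaCongrRight fun i => finRotate (μ i))

/-- `B` is an ordered list of the orbits of `σ` on `{1,…,d}` with `|B_j| = ν_j`:
each `B_j` is an orbit (i.e. a cycle, possibly a fixed point), the `B_j` are
pairwise distinct, every point lies in some `B_j`, and `B_j` has `ν_j` elements. -/
def IsOrbitListing {d n : ℕ} (σ : Equiv.Perm (Fin d)) (ν : Fin n → ℕ)
    (B : Fin n → Set (Fin d)) : Prop :=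
  (∀ j, ∃ x : Fin d, B j = {y | σ.SameCycle x y}) ∧
  Function.Injective B ∧
  (∀ x : Fin d, ∃ j, x ∈ B j) ∧
  (∀ j, (B j).ncard = ν j)

/-- `M_{p,q,r;μ,ν}`: the number of tuples `(τ₁,…,τ_b, σ₂, (B₁,…,B_n))`, `b = p + q + r`, where
each `τᵢ` is a transposition, `(τ₁,…,τ_b)` satisfies the `(p,q)`-monotonicity condition,
`σ₂·τ_b⋯τ₁·σ_μ = id`, the subgroup generated by `σ_μ, τ₁,…,τ_b, σ₂` acts transitively
on `{1,…,d}`, and `(B₁,…,B_n)` is an ordered list of the orbits of `σ₂` with `|B_j| = ν_j`. -/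
noncomputable def Mcount {m n : ℕ} (p q r : ℕ) (μ : Fin m → ℕ) (ν : Fin n → ℕ) : ℕ :=
  Nat.card { t : (Fin (p + q + r) → Equiv.Perm (Fin (∑ i, μ i))) ×
      Equiv.Perm (Fin (∑ i, μ i)) × (Fin n → Set (Fin (∑ i, μ i))) //
    (∀ i, (t.1 i).IsSwap) ∧ MonCond p q t.1 ∧
    t.2.1 * (List.ofFn t.1).reverse.prod * blockPerm μ = 1 ∧
    MulAction.IsPretransitive
      (Subgroup.closure ({blockPerm μ, t.2.1} ∪ Set.range t.1 :
        Set (Equiv.Perm (Fin (∑ i, μ i))))) (Fin (∑ i, μ i)) ∧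
    IsOrbitListing t.2.1 ν t.2.2 }

open Equiv Equiv.Perm
open Function hiding swap

section Cycles

variable {α : Type*}

/-- The cycle of `σ` through `x`, as a set; a singleton if `x` is fixed. -/
def cycleSet (σ : Perm α) (x : α) : Set α := {y | σ.SameCycle x y}

theorem mem_cycleSet {σ : Perm α} {x y : α} : y ∈ cycleSet σ x ↔ σ.SameCycle x y := Iff.rfl

theorem cycleSet_eq_of_mem {σ : Perm α} {x y : α} (h : y ∈ cycleSet σ x) :
    cycleSet σ x = cycleSet σ y := by
  ext v
  exact ⟨fun hv => (SameCycle.symm h).trans hv, fun hv => SameCycle.trans h hv⟩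

theorem minimalPeriod_perm_pos [Finite α] (σ : Perm α) (x : α) : 0 < minimalPeriod σ x :=
  minimalPeriod_pos_of_mem_periodicPts (σ.injective.mem_periodicPts x)

theorem pow_minimalPeriod_apply (σ : Perm α) (x : α) : (σ ^ minimalPeriod σ x) x = x := by
  rw [← iterate_eq_pow]
  exact isPeriodicPt_minimalPeriod σ x

theorem pow_apply_inj {σ : Perm α} {x : α} {i j : ℕ} (hi : i < minimalPeriod σ x)
    (hj : j < minimalPeriod σ x) (h : (σ ^ i) x = (σ ^ j) x) : i = j :=
  iterate_injOn_Iio_minimalPeriod (f := σ) (x := x) hi hj (by simpa [iterate_eq_pow] using h)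

theorem minimalPeriod_pow_apply [Finite α] (σ : Perm α) (x : α) (k : ℕ) :
    minimalPeriod σ ((σ ^ k) x) = minimalPeriod σ x := by
  rw [← iterate_eq_pow]
  exact minimalPeriod_apply_iterate (σ.injective.mem_periodicPts x) k

theorem sameCycle_iff_exists_pow_lt [Finite α] {σ : Perm α} {x y : α} {k : ℕ} (hk : 0 < k)
    (h : (σ ^ k) x = x) : σ.SameCycle x y ↔ ∃ i < k, (σ ^ i) x = y := by
  refine ⟨fun hxy => ?_, fun ⟨i, _, hi⟩ => ⟨i, by simpa using hi⟩⟩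
  obtain ⟨i, rfl⟩ := hxy.exists_nat_pow_eq
  refine ⟨i % k, Nat.mod_lt _ hk, ?_⟩
  have hp : IsPeriodicPt σ k x := by simpa [IsPeriodicPt, IsFixedPt, iterate_eq_pow] using h
  simpa [iterate_eq_pow] using hp.iterate_mod_apply i

theorem SameCycle.exists_pow_lt_minimalPeriod [Finite α] {σ : Perm α} {x y : α}
    (h : σ.SameCycle x y) : ∃ i < minimalPeriod σ x, (σ ^ i) x = y :=
  (sameCycle_iff_exists_pow_lt (minimalPeriod_perm_pos σ x) (pow_minimalPeriod_apply σ x)).1 h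

theorem ncard_setOf_exists_pow_lt {σ : Perm α} {x : α} {k : ℕ} (hk : k ≤ minimalPeriod σ x) :
    {v | ∃ i < k, (σ ^ i) x = v}.ncard = k := by
  have : {v | ∃ i < k, (σ ^ i) x = v} = (fun i => (σ ^ i) x) '' (Finset.range k : Set ℕ) := by
    ext v; simp
  rw [this, Set.InjOn.ncard_image, Set.ncard_coe_finset, Finset.card_range]
  intro i hi j hj h
  simp only [Finset.coe_range, Set.mem_Iio] at hi hj
  exact pow_apply_inj (by omega) (by omega) h

theorem ncard_cycleSet [Finite α] (σ : Perm α) (x : α) :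
    (cycleSet σ x).ncard = minimalPeriod σ x := by
  rw [← ncard_setOf_exists_pow_lt (le_refl (minimalPeriod σ x))]
  congr 1
  ext v
  exact sameCycle_iff_exists_pow_lt (minimalPeriod_perm_pos σ x) (pow_minimalPeriod_apply σ x)

theorem exists_cut [Finite α] {σ : Perm α} {x y : α} (hxy : x ≠ y) (h : σ.SameCycle x y) :
    ∃ k, 0 < k ∧ k < minimalPeriod σ x ∧ (σ ^ k) x = y := by
  obtain ⟨k, hk, rfl⟩ := SameCycle.exists_pow_lt_minimalPeriod h
  refine ⟨k, Nat.pos_of_ne_zero ?_, hk, rfl⟩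
  rintro rfl
  exact hxy (by simp)

/-- Two permutations that agree on the cycle of `u` have the same cycle through `u`. -/
theorem sameCycle_congr [Finite α] {σ ρ : Perm α} {u : α}
    (h : ∀ v, σ.SameCycle u v → ρ v = σ v) (v : α) :
    ρ.SameCycle u v ↔ σ.SameCycle u v := by
  have hp : ∀ i : ℕ, (ρ ^ i) u = (σ ^ i) u := by
    intro i
    induction i with
    | zero => rfl
    | succ i ih =>
      rw [pow_succ', pow_succ', Perm.mul_apply, Perm.mul_apply, ih]
      exact h _ ⟨i, by simp⟩
  constructor
  · intro h'
    obtain ⟨i, rfl⟩ := h'.exists_nat_pow_eq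
    exact ⟨i, by simp [hp]⟩
  · intro h'
    obtain ⟨i, rfl⟩ := h'.exists_nat_pow_eq
    exact ⟨i, by simp [hp]⟩

theorem pow_apply_ne_of_not_sameCycle {σ : Perm α} {x y : α}
    (h : ¬ σ.SameCycle x y) (i : ℕ) (h0 : 0 < i) (hi : i < minimalPeriod σ x) :
    (σ ^ i) x ≠ x ∧ (σ ^ i) x ≠ y :=
  ⟨fun e => h0.ne' (pow_apply_inj (j := 0) hi (by omega) (by simpa using e)),
    fun e => h ⟨i, by simpa using e⟩⟩

variable [DecidableEq α]

theorem swap_mul_pow_apply {σ : Perm α} {x y : α} {k : ℕ}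
    (h : ∀ i, 0 < i → i < k → (σ ^ i) x ≠ x ∧ (σ ^ i) x ≠ y) :
    ∀ i < k, ((swap x y * σ) ^ i) x = (σ ^ i) x := by
  intro i
  induction i with
  | zero => simp
  | succ i ih =>
    intro hi
    have h' := h (i + 1) (by omega) hi
    rw [pow_succ', Perm.mul_apply, ih (by omega), Perm.mul_apply]
    rw [pow_succ', Perm.mul_apply] at h' ⊢
    exact swap_apply_of_ne_of_ne h'.1 h'.2

theorem swap_mul_pow_apply_last {σ : Perm α} {x y : α} {k : ℕ} (hk : 0 < k)
    (h : ∀ i, 0 < i → i < k → (σ ^ i) x ≠ x ∧ (σ ^ i) x ≠ y) :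
    ((swap x y * σ) ^ k) x = swap x y ((σ ^ k) x) := by
  obtain ⟨k, rfl⟩ := Nat.exists_eq_succ_of_ne_zero hk.ne'
  rw [Nat.succ_eq_add_one, pow_succ', Perm.mul_apply, swap_mul_pow_apply h k (by omega),
    Perm.mul_apply, pow_succ' σ, Perm.mul_apply]

section Cut

variable [Finite α] {σ : Perm α} {x : α} {k : ℕ}

theorem sameCycle_cut_left (hk : 0 < k) (hk' : k < minimalPeriod σ x) (v : α) :
    (swap x ((σ ^ k) x) * σ).SameCycle x v ↔ ∃ i < k, (σ ^ i) x = v := by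
  have h : ∀ i, 0 < i → i < k → (σ ^ i) x ≠ x ∧ (σ ^ i) x ≠ (σ ^ k) x := fun i h0 hi =>
    ⟨fun e => h0.ne' (pow_apply_inj (σ := σ) (x := x) (j := 0) (by omega) (by omega)
        (by simpa using e)),
      fun e => hi.ne (pow_apply_inj (by omega) (by omega) e)⟩
  rw [sameCycle_iff_exists_pow_lt hk (by rw [swap_mul_pow_apply_last hk h, swap_apply_right])]
  refine exists_congr fun i => and_congr_right fun hi => ?_
  rw [swap_mul_pow_apply h i hi]

theorem sameCycle_cut_right (hk : 0 < k) (hk' : k < minimalPeriod σ x) (v : α) :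
    (swap x ((σ ^ k) x) * σ).SameCycle ((σ ^ k) x) v ↔
      ∃ i, k ≤ i ∧ i < minimalPeriod σ x ∧ (σ ^ i) x = v := by
  have hx : (σ ^ (minimalPeriod σ x - k)) ((σ ^ k) x) = x := by
    rw [← Perm.mul_apply, ← pow_add, Nat.sub_add_cancel hk'.le, pow_minimalPeriod_apply]
  have := sameCycle_cut_left (σ := σ) (x := (σ ^ k) x) (k := minimalPeriod σ x - k) (by omega)
    (by rw [minimalPeriod_pow_apply]; omega) v
  rw [hx, swap_comm] at this
  rw [this]
  constructor
  · rintro ⟨i, hi, h⟩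
    exact ⟨i + k, by omega, by omega, by rwa [pow_add]⟩
  · rintro ⟨i, h1, h2, h⟩
    refine ⟨i - k, by omega, ?_⟩
    rwa [← Perm.mul_apply, ← pow_add, Nat.sub_add_cancel h1]

theorem not_sameCycle_cut (hk : 0 < k) (hk' : k < minimalPeriod σ x) :
    ¬ (swap x ((σ ^ k) x) * σ).SameCycle x ((σ ^ k) x) := by
  rw [sameCycle_cut_left hk hk']
  rintro ⟨i, hi, h⟩
  exact hi.ne (pow_apply_inj (by omega) hk' h)

theorem ncard_cut_left (hk : 0 < k) (hk' : k < minimalPeriod σ x) :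
    (cycleSet (swap x ((σ ^ k) x) * σ) x).ncard = k := by
  have : cycleSet (swap x ((σ ^ k) x) * σ) x = {v | ∃ i < k, (σ ^ i) x = v} :=
    Set.ext fun v => sameCycle_cut_left hk hk' v
  rw [this, ncard_setOf_exists_pow_lt hk'.le]

theorem sameCycle_cut_or (hk : 0 < k) (hk' : k < minimalPeriod σ x) {v : α}
    (hv : σ.SameCycle x v) : (swap x ((σ ^ k) x) * σ).SameCycle x v ∨
      (swap x ((σ ^ k) x) * σ).SameCycle ((σ ^ k) x) v := by
  rw [sameCycle_cut_left hk hk', sameCycle_cut_right hk hk']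
  obtain ⟨i, hi, h⟩ := SameCycle.exists_pow_lt_minimalPeriod hv
  rcases lt_or_ge i k with h' | h'
  · exact Or.inl ⟨i, h', h⟩
  · exact Or.inr ⟨i, h', hi, h⟩

end Cut

section Join

theorem join_pow_apply {σ : Perm α} {x y : α} (h : ¬ σ.SameCycle x y) {i : ℕ}
    (hi : i < minimalPeriod σ x) :
    ((swap x y * σ) ^ i) x = (σ ^ i) x :=
  swap_mul_pow_apply (pow_apply_ne_of_not_sameCycle h) i hi

variable [Finite α] {σ : Perm α} {x y : α}

theorem join_pow_minimalPeriod (h : ¬ σ.SameCycle x y) :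
    ((swap x y * σ) ^ minimalPeriod σ x) x = y := by
  rw [swap_mul_pow_apply_last (minimalPeriod_perm_pos σ x) (pow_apply_ne_of_not_sameCycle h),
    pow_minimalPeriod_apply, swap_apply_left]

theorem SameCycle.join (h : ¬ σ.SameCycle x y) {v : α} (hv : σ.SameCycle x v) :
    (swap x y * σ).SameCycle x v := by
  obtain ⟨i, hi, rfl⟩ := SameCycle.exists_pow_lt_minimalPeriod hv
  exact ⟨i, by simpa using join_pow_apply h hi⟩

theorem sameCycle_join (h : ¬ σ.SameCycle x y) : (swap x y * σ).SameCycle x y :=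
  ⟨minimalPeriod σ x, by simpa using join_pow_minimalPeriod h⟩

theorem SameCycle.join_right (h : ¬ σ.SameCycle x y) {v : α} (hv : σ.SameCycle y v) :
    (swap x y * σ).SameCycle x v := by
  refine (sameCycle_join h).trans ?_
  rw [swap_comm]
  exact SameCycle.join (fun h' => h h'.symm) hv

theorem sameCycle_swap_mul_of_not_sameCycle {u : α} (hx : ¬ σ.SameCycle u x)
    (hy : ¬ σ.SameCycle u y) (v : α) :
    (swap x y * σ).SameCycle u v ↔ σ.SameCycle u v := by
  refine sameCycle_congr (fun w hw => ?_) v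
  rw [Perm.mul_apply]
  refine swap_apply_of_ne_of_ne ?_ ?_
  · rintro rfl; exact hx (sameCycle_apply_right.2 hw)
  · rintro rfl; exact hy (sameCycle_apply_right.2 hw)

end Join

section CutJoin

variable [Finite α] {σ : Perm α} {x w : α} {k i : ℕ}

theorem not_sameCycle_cut_of_le (hk : 0 < k) (hki : k ≤ i) (hi : i < minimalPeriod σ x) :
    ¬ (swap x ((σ ^ k) x) * σ).SameCycle x ((σ ^ i) x) := by
  rw [sameCycle_cut_left hk (by omega)]
  rintro ⟨j, hj, h⟩
  have := pow_apply_inj (by omega) hi h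
  omega

theorem sameCycle_cut_of_not_sameCycle (hw : ¬ σ.SameCycle x w) (v : α) :
    (swap x ((σ ^ k) x) * σ).SameCycle w v ↔ σ.SameCycle w v :=
  sameCycle_swap_mul_of_not_sameCycle (fun h => hw h.symm)
    (fun h => hw (SameCycle.symm (sameCycle_pow_right.1 h))) v

theorem not_sameCycle_cut_of_not_sameCycle (hw : ¬ σ.SameCycle x w) {u : α}
    (hu : σ.SameCycle x u) : ¬ (swap x ((σ ^ k) x) * σ).SameCycle u w := fun h =>
  hw (hu.trans ((sameCycle_cut_of_not_sameCycle hw u).1 h.symm).symm)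

theorem sameCycle_cut_join_left (hk : 0 < k) (hki : k ≤ i) (hi : i < minimalPeriod σ x)
    (hw : ¬ σ.SameCycle x w) (v : α) :
    (swap ((σ ^ i) x) w * (swap x ((σ ^ k) x) * σ)).SameCycle x v ↔
      (swap x ((σ ^ k) x) * σ).SameCycle x v :=
  sameCycle_swap_mul_of_not_sameCycle (not_sameCycle_cut_of_le hk hki hi)
    (not_sameCycle_cut_of_not_sameCycle hw (SameCycle.refl _ _)) v

theorem ncard_cut_join_left (hk : 0 < k) (hki : k ≤ i) (hi : i < minimalPeriod σ x)
    (hw : ¬ σ.SameCycle x w) :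
    (cycleSet (swap ((σ ^ i) x) w * (swap x ((σ ^ k) x) * σ)) x).ncard = k := by
  have : cycleSet (swap ((σ ^ i) x) w * (swap x ((σ ^ k) x) * σ)) x =
      cycleSet (swap x ((σ ^ k) x) * σ) x :=
    Set.ext fun v => sameCycle_cut_join_left hk hki hi hw v
  rw [this, ncard_cut_left hk (by omega)]

theorem not_sameCycle_cut_join (hk : 0 < k) (hki : k ≤ i) (hi : i < minimalPeriod σ x)
    (hw : ¬ σ.SameCycle x w) :
    ¬ (swap ((σ ^ i) x) w * (swap x ((σ ^ k) x) * σ)).SameCycle x ((σ ^ i) x) := by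
  rw [sameCycle_cut_join_left hk hki hi hw]
  exact not_sameCycle_cut_of_le hk hki hi

theorem sameCycle_cut_join_right (hk : 0 < k) (hki : k ≤ i) (hi : i < minimalPeriod σ x)
    (hw : ¬ σ.SameCycle x w) :
    (swap ((σ ^ i) x) w * (swap x ((σ ^ k) x) * σ)).SameCycle ((σ ^ i) x) ((σ ^ k) x) := by
  refine SameCycle.join (not_sameCycle_cut_of_not_sameCycle hw ?_) (SameCycle.symm ?_)
  · exact sameCycle_pow_right.2 (SameCycle.refl _ _)
  · rw [sameCycle_cut_right hk (by omega)]
    exact ⟨i, hki, hi, rfl⟩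

theorem sameCycle_cut_join_or (hk : 0 < k) (hki : k ≤ i) (hi : i < minimalPeriod σ x)
    (hw : ¬ σ.SameCycle x w) {v : α} (hv : σ.SameCycle x v ∨ σ.SameCycle w v) :
    (swap ((σ ^ i) x) w * (swap x ((σ ^ k) x) * σ)).SameCycle x v ∨
      (swap ((σ ^ i) x) w * (swap x ((σ ^ k) x) * σ)).SameCycle ((σ ^ i) x) v := by
  have hzw := not_sameCycle_cut_of_not_sameCycle (k := k) hw (u := (σ ^ i) x)
    (sameCycle_pow_right.2 (SameCycle.refl _ _))
  rcases hv with hv | hv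
  · rcases sameCycle_cut_or (k := k) hk (by omega) hv with h | h
    · exact Or.inl ((sameCycle_cut_join_left hk hki hi hw v).2 h)
    · refine Or.inr (SameCycle.join hzw (SameCycle.trans (SameCycle.symm ?_) h))
      rw [sameCycle_cut_right hk (by omega)]
      exact ⟨i, hki, hi, rfl⟩
  · exact Or.inr (SameCycle.join_right hzw ((sameCycle_cut_of_not_sameCycle hw v).2 hv))

/-- If `p` lies on the cycle cut by `swap a b`, then `swap a b` can be written as `swap x y` with
`y` on the cyclic path from `x` to `p`. -/
theorem exists_cut_before {a b p : α} (hab : a ≠ b) (h : σ.SameCycle a b)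
    (hp : σ.SameCycle a p) :
    ∃ x k i, σ.SameCycle a x ∧ 0 < k ∧ k ≤ i ∧ i < minimalPeriod σ x ∧ (σ ^ i) x = p ∧
      swap a b = swap x ((σ ^ k) x) := by
  have key : ∀ {a b : α}, a ≠ b → σ.SameCycle a b → (swap a b * σ).SameCycle b p →
      ∃ k i, 0 < k ∧ k ≤ i ∧ i < minimalPeriod σ a ∧ (σ ^ i) a = p ∧
        swap a b = swap a ((σ ^ k) a) := by
    intro a b hab h hbp
    obtain ⟨k, hk, hk', rfl⟩ := exists_cut hab h
    obtain ⟨i, hki, hi, hip⟩ := (sameCycle_cut_right hk hk' p).1 hbp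
    exact ⟨k, i, hk, hki, hi, hip, rfl⟩
  obtain ⟨k, hk, hk', hkb⟩ := exists_cut hab h
  have hor := sameCycle_cut_or hk hk' hp
  rw [hkb] at hor
  rcases hor with h' | h'
  · rw [swap_comm] at h'
    obtain ⟨k, i, h⟩ := key hab.symm h.symm h'
    refine ⟨b, k, i, ‹_›, ?_⟩
    rwa [swap_comm]
  · obtain ⟨k, i, h⟩ := key hab h h'
    exact ⟨a, k, i, SameCycle.refl _ _, h⟩

end CutJoin

end Cycles

section Listing

variable {d : ℕ}

theorem permTop_swap {x y : Fin d} (h : x ≠ y) : permTop (swap x y) = max (x : ℕ) y := by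
  rw [permTop, support_swap h]
  simp

theorem Finset.card_filter_le_val (d m : ℕ) :
    (univ.filter fun x : Fin d => m ≤ x).card = d - m := by
  have h1 := Finset.card_filter_add_card_filter_not (s := (univ : Finset (Fin d)))
    (fun x : Fin d => (x : ℕ) < m)
  simp only [Fin.card_filter_val_lt, not_lt, card_univ, Fintype.card_fin] at h1
  omega

/-- The ordered pair of sets that has `S` at position `j` and `T` at the other one. -/
def pairAt {β : Type*} (j : Fin 2) (S T : β) : Fin 2 → β := fun l => if l = j then S else T

theorem pairAt_self {β : Type*} (j : Fin 2) (S T : β) : pairAt j S T j = S := by simp [pairAt]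

theorem pairAt_of_ne {β : Type*} {j l : Fin 2} (h : l ≠ j) (S T : β) : pairAt j S T l = T := by
  simp [pairAt, h]

theorem IsOrbitListing.eq_cycleSet {n : ℕ} {ρ : Perm (Fin d)} {ν : Fin n → ℕ}
    {B : Fin n → Set (Fin d)} (h : IsOrbitListing ρ ν B) {x : Fin d} {j : Fin n} (hx : x ∈ B j) :
    B j = cycleSet ρ x := by
  obtain ⟨y, hy⟩ := h.1 j
  change B j = cycleSet ρ y at hy
  rw [hy] at hx ⊢
  exact cycleSet_eq_of_mem hx

theorem IsOrbitListing.eq_pairAt {ρ : Perm (Fin d)} {ν : Fin 2 → ℕ} {B : Fin 2 → Set (Fin d)}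
    (h : IsOrbitListing ρ ν B) {x y : Fin d} {j : Fin 2} (hx : x ∈ B j)
    (hxy : ¬ ρ.SameCycle x y) : B = pairAt j (cycleSet ρ x) (cycleSet ρ y) := by
  obtain ⟨l, hl⟩ := h.2.2.1 y
  have hlj : l ≠ j := by
    rintro rfl
    rw [h.eq_cycleSet hx] at hl
    exact hxy hl
  funext i
  by_cases hi : i = j
  · subst hi
    rw [pairAt_self, h.eq_cycleSet hx]
  · have : i = l := by omega
    rw [pairAt_of_ne hi, this, h.eq_cycleSet hl]

theorem isOrbitListing_pairAt {ρ : Perm (Fin d)} {ν : Fin 2 → ℕ} (hν : ν 0 + ν 1 = d)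
    {x y : Fin d} (hxy : ¬ ρ.SameCycle x y) (hall : ∀ v, ρ.SameCycle x v ∨ ρ.SameCycle y v)
    {j : Fin 2} (hj : (cycleSet ρ x).ncard = ν j) :
    IsOrbitListing ρ ν (pairAt j (cycleSet ρ x) (cycleSet ρ y)) := by
  have hne : ∃ l : Fin 2, l ≠ j := ⟨1 - j, by fin_cases j <;> decide⟩
  obtain ⟨l₀, hl₀⟩ := hne
  have hc : cycleSet ρ y = (cycleSet ρ x)ᶜ := by
    ext v
    constructor
    · exact fun hv hv' => hxy (SameCycle.trans hv' (SameCycle.symm hv))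
    · exact fun hv => (hall v).resolve_left hv
  refine ⟨fun l => ?_, ?_, fun v => ?_, fun l => ?_⟩
  · by_cases hl : l = j
    · exact ⟨x, by subst hl; rw [pairAt_self]; rfl⟩
    · exact ⟨y, by rw [pairAt_of_ne hl]; rfl⟩
  · have hS : cycleSet ρ x ≠ cycleSet ρ y := fun h => hxy (by
      have : y ∈ cycleSet ρ y := SameCycle.refl _ _
      rwa [← h] at this)
    intro l l' h
    by_cases hl : l = j <;> by_cases hl' : l' = j
    · rw [hl, hl']
    · subst hl
      rw [pairAt_self, pairAt_of_ne hl'] at h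
      exact absurd h hS
    · subst hl'
      rw [pairAt_self, pairAt_of_ne hl] at h
      exact absurd h.symm hS
    · omega
  · rcases hall v with h | h
    · exact ⟨j, by rw [pairAt_self]; exact h⟩
    · exact ⟨l₀, by rw [pairAt_of_ne hl₀]; exact h⟩
  · by_cases hl : l = j
    · subst hl
      rw [pairAt_self, hj]
    · rw [pairAt_of_ne hl, hc, Set.ncard_compl, hj, Nat.card_eq_fintype_card, Fintype.card_fin]
      have : ν j + ν l = ν 0 + ν 1 := by
        fin_cases j <;> fin_cases l <;> first | rfl | exact Nat.add_comm _ _ | exact absurd rfl hl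
      omega

end Listing

section TwoBlocks

variable {d m : ℕ}

/-- The cycles of `σ` are the two initial and final blocks `{x | x < m}` and `{x | m ≤ x}`. -/
def HasTwoBlocks (σ : Perm (Fin d)) (m : ℕ) : Prop :=
  ∀ x y, σ.SameCycle x y ↔ ((x : ℕ) < m ↔ (y : ℕ) < m)

/-- `τ` moves a point of `{x | x < m}` into `{x | m ≤ x}`. -/
def Crosses (m : ℕ) (τ : Perm (Fin d)) : Prop := ∃ u : Fin d, (u : ℕ) < m ∧ m ≤ (τ u : ℕ)

theorem Crosses.exists_eq_swap {τ : Perm (Fin d)} (h : Crosses m τ) (hτ : τ.IsSwap) :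
    ∃ a b : Fin d, (a : ℕ) < m ∧ m ≤ (b : ℕ) ∧ τ = swap a b := by
  obtain ⟨u, hu, hu'⟩ := h
  obtain ⟨x, y, -, rfl⟩ := hτ
  rcases eq_or_ne u x with rfl | hx
  · exact ⟨u, y, hu, by simpa using hu', rfl⟩
  rcases eq_or_ne u y with rfl | hy
  · exact ⟨u, x, hu, by simpa using hu', swap_comm _ _⟩
  rw [swap_apply_of_ne_of_ne hx hy] at hu'
  omega

theorem crosses_swap {a b : Fin d} (ha : (a : ℕ) < m) (hb : m ≤ (b : ℕ)) :
    Crosses m (swap a b) := ⟨a, ha, by simpa using hb⟩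

theorem not_crosses_swap {a b : Fin d} (h : (a : ℕ) < m ↔ (b : ℕ) < m) :
    ¬ Crosses m (swap a b) := by
  rintro ⟨u, hu, hu'⟩
  rw [swap_apply_def] at hu'
  split_ifs at hu' with h1 h2
  · subst h1; omega
  · subst h2; omega
  · omega

theorem swap_eq_swap_of_crosses {a b a' b' : Fin d} (ha : (a : ℕ) < m) (hb : m ≤ (b : ℕ))
    (ha' : (a' : ℕ) < m) (hb' : m ≤ (b' : ℕ)) (h : swap a b = swap a' b') : a = a' ∧ b = b' := by
  have hab : a ≠ b := by rintro rfl; omega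
  have h1 : swap a' b' a ≠ a := by rw [← h, swap_apply_left]; exact hab.symm
  have haa : a = a' := by
    by_contra hne
    refine h1 (swap_apply_of_ne_of_ne hne ?_)
    rintro rfl; omega
  subst haa
  refine ⟨rfl, ?_⟩
  have := congrArg (fun f : Perm (Fin d) => f a) h
  simpa using this

namespace HasTwoBlocks

variable {σ : Perm (Fin d)}

theorem minimalPeriod_of_lt (hσ : HasTwoBlocks σ m) (hm : m ≤ d) {x : Fin d} (hx : (x : ℕ) < m) :
    minimalPeriod σ x = m := by
  have : cycleSet σ x = ((Finset.univ.filter fun y : Fin d => (y : ℕ) < m : Finset _) : Set _) := by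
    ext y
    simp [mem_cycleSet, hσ x y, hx]
  rw [← ncard_cycleSet, this, Set.ncard_coe_finset, Fin.card_filter_val_lt]
  omega

theorem minimalPeriod_of_le (hσ : HasTwoBlocks σ m)
    {x : Fin d} (hx : m ≤ (x : ℕ)) : minimalPeriod σ x = d - m := by
  have : cycleSet σ x = ((Finset.univ.filter fun y : Fin d => m ≤ (y : ℕ) : Finset _) : Set _) := by
    ext y
    simp [mem_cycleSet, hσ x y, hx.not_gt]
  rw [← ncard_cycleSet, this, Set.ncard_coe_finset, Finset.card_filter_le_val]

theorem pow_lt_iff (hσ : HasTwoBlocks σ m)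
    (x : Fin d) (i : ℕ) : ((σ ^ i) x : ℕ) < m ↔ (x : ℕ) < m :=
  ((hσ x ((σ ^ i) x)).1 (sameCycle_pow_right.2 (SameCycle.refl _ _))).symm

theorem not_sameCycle (hσ : HasTwoBlocks σ m) {a b : Fin d} (ha : (a : ℕ) < m) (hb : m ≤ (b : ℕ)) :
    ¬ σ.SameCycle a b := by
  rw [hσ]; omega

section Join

variable {a b : Fin d}

theorem sameCycle_join (hσ : HasTwoBlocks σ m) (ha : (a : ℕ) < m) (hb : m ≤ (b : ℕ))
    (x y : Fin d) : (swap a b * σ).SameCycle x y := by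
  have key : ∀ v, (swap a b * σ).SameCycle a v := by
    intro v
    rcases lt_or_ge (v : ℕ) m with hv | hv
    · exact SameCycle.join (hσ.not_sameCycle ha hb) ((hσ a v).2 (by omega))
    · exact SameCycle.join_right (hσ.not_sameCycle ha hb) ((hσ b v).2 (by omega))
  exact (key x).symm.trans (key y)

theorem minimalPeriod_join (hσ : HasTwoBlocks σ m) (ha : (a : ℕ) < m) (hb : m ≤ (b : ℕ))
    (x : Fin d) : minimalPeriod (swap a b * σ) x = d := by
  have : cycleSet (swap a b * σ) x = Set.univ :=
    Set.eq_univ_of_forall fun y => hσ.sameCycle_join ha hb x y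
  rw [← ncard_cycleSet, this, Set.ncard_univ, Nat.card_eq_fintype_card, Fintype.card_fin]

theorem join_pow_lt (hσ : HasTwoBlocks σ m) (ha : (a : ℕ) < m) (hb : m ≤ (b : ℕ))
    {k : ℕ} (hk : d - m ≤ k) (hk' : k ≤ m) {x : Fin d} (hx : m ≤ (x : ℕ)) :
    (((swap a b * σ) ^ k) x : ℕ) < m := by
  have hmd : m ≤ d := by omega
  have hba : ¬ σ.SameCycle b a := fun h => hσ.not_sameCycle ha hb h.symm
  obtain ⟨i, hi, hix⟩ := SameCycle.exists_pow_lt_minimalPeriod ((hσ b x).2 (by omega))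
  have h1 := join_pow_apply hba hi
  have h2 := join_pow_minimalPeriod hba
  rw [hσ.minimalPeriod_of_le hb, swap_comm] at h2
  rw [hσ.minimalPeriod_of_le hb] at hi
  rw [swap_comm, hix] at h1
  have h3 := join_pow_apply (hσ.not_sameCycle ha hb) (i := k + i - (d - m))
    (by rw [hσ.minimalPeriod_of_lt hmd ha]; omega)
  have h4 : k + i = (k + i - (d - m)) + (d - m) := by omega
  rw [← h1, ← Perm.mul_apply, ← pow_add, h4, pow_add, Perm.mul_apply, h2, h3, hσ.pow_lt_iff]
  exact ha

end Join

end HasTwoBlocks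

end TwoBlocks

section Count

variable {d m : ℕ}

/-- The triples `(τ₁, τ₂, B)` to be counted: the permutation `σ₂` is determined by the rest, and
transitivity means that `τ₁` or `τ₂` connects the two blocks. -/
def monotoneTriples (σ : Perm (Fin d)) (m : ℕ) (ν : Fin 2 → ℕ) :
    Set (Perm (Fin d) × Perm (Fin d) × (Fin 2 → Set (Fin d))) :=
  {t | t.1.IsSwap ∧ t.2.1.IsSwap ∧ permTop t.1 ≤ permTop t.2.1 ∧
    (Crosses m t.1 ∨ Crosses m t.2.1) ∧ IsOrbitListing (t.2.1 * (t.1 * σ)) ν t.2.2}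

/-- The triple in which `τ₁ = (a b)` joins the two blocks and `τ₂` then cuts off the path of length
`k` starting at `x`. -/
def joinCut (σ : Perm (Fin d)) (k : ℕ) (t : (_ : Fin d × Fin d) × Fin d) :
    Perm (Fin d) × Perm (Fin d) × (Fin 2 → Set (Fin d)) :=
  let c := swap t.1.1 t.1.2 * σ
  let τ := swap t.2 ((c ^ k) t.2)
  (swap t.1.1 t.1.2, τ, pairAt 0 (cycleSet (τ * c) t.2) (cycleSet (τ * c) ((c ^ k) t.2)))

/-- The parameters for which `joinCut` satisfies the monotonicity condition. -/
def joinCutIndex (σ : Perm (Fin d)) (m k : ℕ) : Finset ((_ : Fin d × Fin d) × Fin d) :=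
  ((Finset.univ.filter fun a : Fin d => (a : ℕ) < m) ×ˢ
    (Finset.univ.filter fun b : Fin d => m ≤ (b : ℕ))).sigma fun p =>
      Finset.univ.filter fun x : Fin d => p.2 ≤ x ∨ p.2 ≤ ((swap p.1 p.2 * σ) ^ k) x

/-- The triple in which `τ₁` cuts off the path of length `ν j` starting at `x` from the first block,
and `τ₂ = (σ ^ i x, w)` joins the rest of it to the second block. -/
def cutJoin (σ : Perm (Fin d)) (ν : Fin 2 → ℕ) (t : (_ : Fin 2) × Fin d × ℕ × Fin d) :
    Perm (Fin d) × Perm (Fin d) × (Fin 2 → Set (Fin d)) :=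
  let c := swap t.2.1 ((σ ^ ν t.1) t.2.1) * σ
  let z := (σ ^ t.2.2.1) t.2.1
  let τ := swap z t.2.2.2
  (swap t.2.1 ((σ ^ ν t.1) t.2.1), τ,
    pairAt t.1 (cycleSet (τ * c) t.2.1) (cycleSet (τ * c) z))

/-- The parameters of `cutJoin`. -/
def cutJoinIndex (d m : ℕ) (ν : Fin 2 → ℕ) : Finset ((_ : Fin 2) × Fin d × ℕ × Fin d) :=
  Finset.univ.sigma fun j => (Finset.univ.filter fun x : Fin d => (x : ℕ) < m) ×ˢ
    Finset.Ico (ν j) m ×ˢ (Finset.univ.filter fun w : Fin d => m ≤ (w : ℕ))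

theorem mem_joinCutIndex {σ : Perm (Fin d)} {k : ℕ} {a b x : Fin d} :
    ⟨(a, b), x⟩ ∈ joinCutIndex σ m k ↔ ((a : ℕ) < m ∧ m ≤ (b : ℕ)) ∧
      (b ≤ x ∨ b ≤ ((swap a b * σ) ^ k) x) := by
  simp [joinCutIndex]

theorem mem_cutJoinIndex {ν : Fin 2 → ℕ} {j : Fin 2} {x w : Fin d} {i : ℕ} :
    ⟨j, x, i, w⟩ ∈ cutJoinIndex d m ν ↔
      (x : ℕ) < m ∧ (ν j ≤ i ∧ i < m) ∧ m ≤ (w : ℕ) := by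
  simp [cutJoinIndex]

theorem sum_sub_filter_le (d m : ℕ) (hm : m ≤ d) :
    ∑ b ∈ Finset.univ.filter (fun b : Fin d => m ≤ (b : ℕ)), 2 * (d - (b : ℕ)) =
      (d - m) * (d - m + 1) := by
  rw [Finset.sum_filter, Fin.sum_univ_eq_sum_range (fun b => if m ≤ b then 2 * (d - b) else 0) d,
    ← Finset.sum_filter]
  obtain ⟨n, rfl⟩ := Nat.exists_eq_add_of_le hm
  have : (Finset.range (m + n)).filter (fun b => m ≤ b) = Finset.Ico m (m + n) := by
    ext b; simp; omega
  rw [this, Finset.sum_Ico_eq_sum_range, Nat.add_sub_cancel_left]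
  clear this hm
  induction n with
  | zero => simp
  | succ n ih =>
    rw [Finset.sum_range_succ']
    have : ∀ k, 2 * (m + (n + 1) - (m + (k + 1))) = 2 * (m + n - (m + k)) := fun k => by omega
    simp only [this, ih]
    have : m + (n + 1) - (m + 0) = n + 1 := by omega
    rw [this]
    ring

namespace HasTwoBlocks

variable {σ : Perm (Fin d)}

theorem card_joinCutIndex (hσ : HasTwoBlocks σ m)
    (hm : m ≤ d) {k : ℕ} (hk : d - m ≤ k) (hk' : k ≤ m) :
    (joinCutIndex σ m k).card = m * ((d - m) * (d - m + 1)) := by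
  have key : ∀ p ∈ (Finset.univ.filter fun a : Fin d => (a : ℕ) < m) ×ˢ
      (Finset.univ.filter fun b : Fin d => m ≤ (b : ℕ)),
      (Finset.univ.filter fun x : Fin d => p.2 ≤ x ∨ p.2 ≤ ((swap p.1 p.2 * σ) ^ k) x).card =
        2 * (d - (p.2 : ℕ)) := by
    rintro ⟨a, b⟩ hp
    simp only [Finset.mem_product, Finset.mem_filter, Finset.mem_univ, true_and] at hp
    obtain ⟨ha, hb⟩ := hp
    have h1 : (Finset.univ.filter fun x : Fin d => b ≤ x).card = d - (b : ℕ) :=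
      Finset.card_filter_le_val d b
    have h2 : (Finset.univ.filter fun x : Fin d => b ≤ ((swap a b * σ) ^ k) x).card =
        d - (b : ℕ) := by
      rw [← h1]
      refine Finset.card_equiv ((swap a b * σ) ^ k) fun x => ?_
      simp
    rw [Finset.filter_or, Finset.card_union_of_disjoint, h1, h2, two_mul]
    rw [Finset.disjoint_filter]
    intro x _ hx hx'
    have := hσ.join_pow_lt ha hb hk hk' (x := x) (hb.trans hx)
    have : (b : ℕ) ≤ (((swap a b * σ) ^ k) x : ℕ) := hx'
    omega
  rw [joinCutIndex, Finset.card_sigma, Finset.sum_congr rfl key, Finset.sum_product]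
  simp only [sum_sub_filter_le d m hm, Finset.sum_const, Fin.card_filter_val_lt, smul_eq_mul]
  rw [min_eq_right hm]

theorem card_cutJoinIndex (hm : m ≤ d) (ν : Fin 2 → ℕ) :
    (cutJoinIndex d m ν).card = m * ((m - ν 0) * (d - m)) + m * ((m - ν 1) * (d - m)) := by
  simp [cutJoinIndex, Finset.card_sigma, Finset.card_product, Fin.card_filter_val_lt,
    Finset.card_filter_le_val, min_eq_right hm]

variable {ν : Fin 2 → ℕ}

theorem joinCut_injOn (hσ : HasTwoBlocks σ m) (h0 : 0 < ν 0) (hd : ν 0 < d) :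
    Set.InjOn (joinCut σ (ν 0)) (joinCutIndex σ m (ν 0)) := by
  rintro ⟨⟨a, b⟩, x⟩ h ⟨⟨a', b'⟩, x'⟩ h' e
  rw [Finset.mem_coe, mem_joinCutIndex] at h h'
  simp only [joinCut, Prod.mk.injEq] at e
  obtain ⟨e1, e2, e3⟩ := e
  obtain ⟨rfl, rfl⟩ := swap_eq_swap_of_crosses h.1.1 h.1.2 h'.1.1 h'.1.2 e1
  have hx : x ∈ ({x', ((swap a b * σ) ^ ν 0) x'} : Finset (Fin d)) := by
    have hne : ∀ u, u ≠ ((swap a b * σ) ^ ν 0) u := fun u hu => h0.ne' <| pow_apply_inj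
      (σ := swap a b * σ) (x := u) (j := 0) (by rwa [hσ.minimalPeriod_join h.1.1 h.1.2])
      (by rw [hσ.minimalPeriod_join h.1.1 h.1.2]; omega) (by simpa using hu.symm)
    rw [← support_swap (hne x'), ← e2, support_swap (hne x)]
    simp
  have hB := congrFun e3 0
  rw [← e2, pairAt_self, pairAt_self] at hB
  have hx' : x' ∈ cycleSet (swap x (((swap a b * σ) ^ ν 0) x) * (swap a b * σ)) x := by
    rw [hB]; exact SameCycle.refl _ _
  rw [mem_cycleSet, e2] at hx'
  have hcut := not_sameCycle_cut (σ := swap a b * σ) (x := x') h0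
    (by rwa [hσ.minimalPeriod_join h.1.1 h.1.2])
  simp only [Finset.mem_insert, Finset.mem_singleton] at hx
  rcases hx with rfl | hx
  · rfl
  · rw [← hx] at hcut hx'
    exact absurd hx'.symm hcut

theorem cutJoin_injOn (hσ : HasTwoBlocks σ m) (hm : m ≤ d) (h0 : ∀ j, 0 < ν j) :
    Set.InjOn (cutJoin σ ν) (cutJoinIndex d m ν) := by
  rintro ⟨j, x, i, w⟩ h ⟨j', x', i', w'⟩ h' e
  rw [Finset.mem_coe, mem_cutJoinIndex] at h h'
  obtain ⟨hx, ⟨hji, hi⟩, hw⟩ := h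
  obtain ⟨hx', ⟨hji', hi'⟩, hw'⟩ := h'
  simp only [cutJoin, Prod.mk.injEq] at e
  obtain ⟨e1, e2, e3⟩ := e
  have hp := hσ.minimalPeriod_of_lt hm hx
  have hp' := hσ.minimalPeriod_of_lt hm hx'
  obtain ⟨ez, rfl⟩ := swap_eq_swap_of_crosses ((hσ.pow_lt_iff x i).2 hx) hw
    ((hσ.pow_lt_iff x' i').2 hx') hw' e2
  have hsep := not_sameCycle_cut_join (h0 j) hji (hp ▸ hi) (hσ.not_sameCycle hx hw)
  have hsep' := not_sameCycle_cut_join (h0 j') hji' (hp' ▸ hi') (hσ.not_sameCycle hx' hw)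
  have hy := sameCycle_cut_join_right (h0 j) hji (hp ▸ hi) (hσ.not_sameCycle hx hw)
  have hne : x ≠ (σ ^ ν j) x := fun hu => (h0 j).ne' <| pow_apply_inj
    (σ := σ) (x := x) (j := 0) (by omega) (by omega) (by simpa using hu.symm)
  have hne' : x' ≠ (σ ^ ν j') x' := fun hu => (h0 j').ne' <| pow_apply_inj
    (σ := σ) (x := x') (j := 0) (by omega) (by omega) (by simpa using hu.symm)
  have hxx : x' ∈ ({x, (σ ^ ν j) x} : Finset (Fin d)) := by
    rw [← support_swap hne, e1, support_swap hne']
    simp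
  rw [← ez, ← e1] at hsep' e3
  have hjj : j = j' := by
    by_contra hjj
    have h1 := congrFun e3 j
    rw [pairAt_self, pairAt_of_ne hjj] at h1
    have h2 : (σ ^ i) x ∈ cycleSet (swap ((σ ^ i) x) w * (swap x ((σ ^ ν j) x) * σ)) x := by
      rw [h1]; exact SameCycle.refl _ _
    exact hsep h2
  subst hjj
  have hxx' : x = x' := by
    simp only [Finset.mem_insert, Finset.mem_singleton] at hxx
    rcases hxx with rfl | hxx
    · rfl
    · rw [hxx] at hsep'
      exact absurd hy.symm hsep'
  subst hxx'
  have := pow_apply_inj (by omega) (by omega) ez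
  subst this
  rfl

theorem joinCut_mem (hσ : HasTwoBlocks σ m) (hν : ν 0 + ν 1 = d) (h0 : ∀ j, 0 < ν j) {t}
    (ht : t ∈ joinCutIndex σ m (ν 0)) : joinCut σ (ν 0) t ∈ monotoneTriples σ m ν := by
  obtain ⟨⟨a, b⟩, x⟩ := t
  obtain ⟨⟨ha, hb⟩, hx⟩ := mem_joinCutIndex.1 ht
  have hp := hσ.minimalPeriod_join ha hb
  have h1 := h0 0
  have h2 := h0 1
  have hlt : ν 0 < minimalPeriod (swap a b * σ) x := by rw [hp]; omega
  have hne : x ≠ ((swap a b * σ) ^ ν 0) x := fun hu => h1.ne' <| pow_apply_inj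
    (σ := swap a b * σ) (x := x) (j := 0) hlt (by omega) (by simpa using hu.symm)
  have hab : a ≠ b := by rintro rfl; omega
  refine ⟨⟨a, b, hab, rfl⟩, ⟨x, _, hne, rfl⟩, ?_, Or.inl (crosses_swap ha hb), ?_⟩
  · simp only [joinCut]
    rw [permTop_swap hab, permTop_swap hne, max_eq_right (by omega)]
    exact le_max_iff.2 hx
  · exact isOrbitListing_pairAt hν (not_sameCycle_cut h1 hlt)
      (fun v => sameCycle_cut_or h1 hlt (hσ.sameCycle_join ha hb x v)) (ncard_cut_left h1 hlt)

theorem cutJoin_mem (hσ : HasTwoBlocks σ m)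
    (hm : m ≤ d) (hν : ν 0 + ν 1 = d) (h0 : ∀ j, 0 < ν j) {t}
    (ht : t ∈ cutJoinIndex d m ν) : cutJoin σ ν t ∈ monotoneTriples σ m ν := by
  obtain ⟨j, x, i, w⟩ := t
  obtain ⟨hx, ⟨hji, hi⟩, hw⟩ := mem_cutJoinIndex.1 ht
  have hp := hσ.minimalPeriod_of_lt hm hx
  have hxw := hσ.not_sameCycle hx hw
  have hz := (hσ.pow_lt_iff x i).2 hx
  have hy := (hσ.pow_lt_iff x (ν j)).2 hx
  have hne : x ≠ (σ ^ ν j) x := fun hu => (h0 j).ne' <| pow_apply_inj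
    (σ := σ) (x := x) (j := 0) (by omega) (by omega) (by simpa using hu.symm)
  have hzw : (σ ^ i) x ≠ w := by intro h; rw [h] at hz; omega
  refine ⟨⟨x, _, hne, rfl⟩, ⟨_, w, hzw, rfl⟩, ?_, Or.inr (crosses_swap hz hw), ?_⟩
  · simp only [cutJoin]
    rw [permTop_swap hne, permTop_swap hzw]
    omega
  · refine isOrbitListing_pairAt hν (not_sameCycle_cut_join (h0 j) hji (by omega) hxw)
      (fun v => sameCycle_cut_join_or (h0 j) hji (by omega) hxw ?_)
      (ncard_cut_join_left (h0 j) hji (by omega) hxw)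
    rw [hσ, hσ]
    omega

theorem monotoneTriples_subset (hσ : HasTwoBlocks σ m) (hm : m ≤ d) (hlt : ∀ j, d - m < ν j) {t}
    (ht : t ∈ monotoneTriples σ m ν) :
    (∃ p ∈ joinCutIndex σ m (ν 0), joinCut σ (ν 0) p = t) ∨
      ∃ p ∈ cutJoinIndex d m ν, cutJoin σ ν p = t := by
  obtain ⟨τ₁, τ₂, B⟩ := t
  obtain ⟨h1, h2, htop, hc, hB⟩ := ht
  simp only at h1 h2 htop hc hB
  by_cases hc1 : Crosses m τ₁
  · left
    obtain ⟨a, b, ha, hb, rfl⟩ := hc1.exists_eq_swap h1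
    have hab : a ≠ b := by rintro rfl; omega
    have key : ∀ x y, x ≠ y → τ₂ = swap x y → x ∈ B 0 →
        ∃ p ∈ joinCutIndex σ m (ν 0), joinCut σ (ν 0) p = (swap a b, τ₂, B) := by
      rintro x y hxy rfl hx
      obtain ⟨k, hk, hk', rfl⟩ := exists_cut hxy (hσ.sameCycle_join ha hb x y)
      have hkν : ν 0 = k := by
        rw [← hB.2.2.2 0, hB.eq_cycleSet hx, ncard_cut_left hk hk']
      rw [hkν]
      refine ⟨⟨(a, b), x⟩, mem_joinCutIndex.2 ⟨⟨ha, hb⟩, ?_⟩, ?_⟩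
      · rw [permTop_swap hab, permTop_swap hxy, max_eq_right (by omega)] at htop
        exact le_max_iff.1 htop
      · rw [hB.eq_pairAt hx (not_sameCycle_cut hk hk')]
        rfl
    obtain ⟨x, y, hxy, hτ⟩ := h2
    obtain ⟨j, hj⟩ := hB.2.2.1 x
    obtain ⟨k, hk, hk', hy⟩ := exists_cut hxy (hσ.sameCycle_join ha hb x y)
    have hsep := not_sameCycle_cut hk hk'
    rw [hy, ← hτ] at hsep
    have hBj := hB.eq_pairAt hj hsep
    by_cases hj0 : j = 0
    · subst hj0
      exact key x y hxy hτ hj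
    · refine key y x hxy.symm (by rw [hτ, swap_comm]) ?_
      rw [hBj, pairAt_of_ne (Ne.symm hj0)]
      exact SameCycle.refl _ _
  · have hc2 := hc.resolve_left hc1
    obtain ⟨a, b, hab, rfl⟩ := h1
    obtain ⟨p, q, hp, hq, rfl⟩ := hc2.exists_eq_swap h2
    have hside : (a : ℕ) < m ↔ (b : ℕ) < m := by
      by_contra hside
      rcases lt_or_ge (a : ℕ) m with ha | ha
      · exact hc1 (crosses_swap ha (by omega))
      · rw [swap_comm] at hc1
        exact hc1 (crosses_swap (by omega) ha)
    rcases lt_or_ge (a : ℕ) m with ha | ha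
    · right
      obtain ⟨x, k, i, hax, hk, hki, hi, rfl, e⟩ :=
        exists_cut_before hab ((hσ a b).2 hside) ((hσ a p).2 (by omega))
      rw [e] at hB ⊢
      have hx : (x : ℕ) < m := by rw [hσ] at hax; omega
      have hxq := hσ.not_sameCycle hx hq
      obtain ⟨j, hj⟩ := hB.2.2.1 x
      have hjν : ν j = k := by
        rw [← hB.2.2.2 j, hB.eq_cycleSet hj, ncard_cut_join_left hk hki hi hxq]
      subst hjν
      refine ⟨⟨j, x, i, q⟩, mem_cutJoinIndex.2 ⟨hx, ⟨hki, ?_⟩, hq⟩, ?_⟩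
      · rwa [hσ.minimalPeriod_of_lt hm hx] at hi
      · rw [hB.eq_pairAt hj (not_sameCycle_cut_join hk hki hi hxq)]
        rfl
    · exfalso
      obtain ⟨x, k, i, hax, hk, hki, hi, rfl, e⟩ :=
        exists_cut_before hab ((hσ a b).2 hside) ((hσ a q).2 (by omega))
      rw [e, swap_comm p] at hB
      have hx : m ≤ (x : ℕ) := by rw [hσ] at hax; omega
      have hxp : ¬ σ.SameCycle x p := fun h => hσ.not_sameCycle hp hx h.symm
      obtain ⟨j, hj⟩ := hB.2.2.1 x
      have hjν : ν j = k := by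
        rw [← hB.2.2.2 j, hB.eq_cycleSet hj, ncard_cut_join_left hk hki hi hxp]
      rw [hσ.minimalPeriod_of_le hx] at hi
      have := hlt j
      omega

theorem ncard_monotoneTriples (hσ : HasTwoBlocks σ m)
    (hm : m ≤ d) (hν : ν 0 + ν 1 = d) (hlt : ∀ j, d - m < ν j)
    (hle : ν 0 ≤ m) : (monotoneTriples σ m ν).ncard =
      m * ((d - m) * (d - m + 1)) + (m * ((m - ν 0) * (d - m)) + m * ((m - ν 1) * (d - m))) := by
  have h0 : ∀ j, 0 < ν j := fun j => by have := hlt j; omega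
  have h1 := h0 1
  have heq : monotoneTriples σ m ν = joinCut σ (ν 0) '' (joinCutIndex σ m (ν 0)) ∪
      cutJoin σ ν '' (cutJoinIndex d m ν) := by
    ext t
    constructor
    · exact fun ht => hσ.monotoneTriples_subset hm hlt ht
    · rintro (⟨p, hp, rfl⟩ | ⟨p, hp, rfl⟩)
      · exact hσ.joinCut_mem hν h0 hp
      · exact hσ.cutJoin_mem hm hν h0 hp
  have hdisj : Disjoint (joinCut σ (ν 0) '' (joinCutIndex σ m (ν 0) : Set _))
      (cutJoin σ ν '' (cutJoinIndex d m ν)) := by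
    rw [Set.disjoint_left]
    rintro _ ⟨⟨⟨a, b⟩, x⟩, hp, rfl⟩ ⟨⟨j, y, i, w⟩, hq, e⟩
    rw [Finset.mem_coe, mem_joinCutIndex] at hp
    rw [Finset.mem_coe, mem_cutJoinIndex] at hq
    have e1 : swap y ((σ ^ ν j) y) = swap a b := congrArg Prod.fst e
    refine not_crosses_swap (m := m) ?_ (e1 ▸ crosses_swap hp.1.1 hp.1.2)
    exact (hσ.pow_lt_iff y (ν j)).symm
  rw [heq, Set.ncard_union_eq hdisj (Set.toFinite _) (Set.toFinite _),
    (hσ.joinCut_injOn (h0 0) (by omega)).ncard_image, (hσ.cutJoin_injOn hm h0).ncard_image,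
    Set.ncard_coe_finset, Set.ncard_coe_finset, hσ.card_joinCutIndex hm (hlt 0).le hle,
    card_cutJoinIndex hm]

end HasTwoBlocks

end Count

section Reduction

variable {d m : ℕ}

theorem HasTwoBlocks.isPretransitive_iff {σ s : Perm (Fin d)} (hσ : HasTwoBlocks σ m) (h0 : 0 < m)
    (hm : m < d) {τ : Fin 2 → Perm (Fin d)} (hτ : ∀ i, (τ i).IsSwap)
    (hs : s = (τ 1 * (τ 0 * σ))⁻¹) :
    MulAction.IsPretransitive
      (Subgroup.closure ({σ, s} ∪ Set.range τ : Set (Perm (Fin d)))) (Fin d) ↔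
      Crosses m (τ 0) ∨ Crosses m (τ 1) := by
  constructor
  · intro h
    by_contra hc
    have hnot : ∀ i, ¬ Crosses m (τ i) := by
      intro i hi
      fin_cases i
      · exact hc (Or.inl hi)
      · exact hc (Or.inr hi)
    have hswap : ∀ i (u : Fin d), (τ i u : ℕ) < m ↔ (u : ℕ) < m := by
      intro i u
      have hlt : ∀ u : Fin d, (u : ℕ) < m → (τ i u : ℕ) < m := fun u hu => by
        by_contra hu'
        exact hnot i ⟨u, hu, not_lt.1 hu'⟩
      refine ⟨fun hu => ?_, hlt u⟩
      obtain ⟨x, y, -, e⟩ := hτ i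
      have := hlt _ hu
      rwa [e, swap_apply_self] at this
    have hσ' : ∀ u : Fin d, (σ u : ℕ) < m ↔ (u : ℕ) < m := fun u => by
      simpa using hσ.pow_lt_iff u 1
    have key : ∀ g ∈ Subgroup.closure ({σ, s} ∪ Set.range τ : Set (Perm (Fin d))),
        ∀ u : Fin d, (g u : ℕ) < m ↔ (u : ℕ) < m := by
      intro g hg
      induction hg using Subgroup.closure_induction with
      | mem g hg =>
        rcases hg with (rfl | rfl) | ⟨i, rfl⟩
        · exact hσ'
        · intro u
          have h1 : τ 1 (τ 0 (σ (g u))) = u := by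
            rw [hs, ← Perm.mul_apply, ← Perm.mul_apply]
            exact (τ 1 * (τ 0 * σ)).apply_symm_apply u
          conv_rhs => rw [← h1]
          rw [hswap, hswap, hσ']
        · exact hswap i
      | one => simp
      | mul g g' _ _ ih ih' => intro u; rw [Perm.mul_apply, ih, ih']
      | inv g _ ih => 
      intro u
      rw [← ih]
      exact iff_of_eq (congrArg (fun v : Fin d => (v : ℕ) < m) (g.apply_symm_apply u))
    obtain ⟨g, hg⟩ := h.exists_smul_eq ⟨0, h0.trans hm⟩ ⟨m, hm⟩
    have h1 := key g g.2 ⟨0, h0.trans hm⟩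
    have h2 : (g : Perm (Fin d)) ⟨0, h0.trans hm⟩ = ⟨m, hm⟩ := hg
    rw [h2] at h1
    simp [h0] at h1
  · intro h
    have : ∃ i, Crosses m (τ i) := by
      rcases h with h | h
      · exact ⟨0, h⟩
      · exact ⟨1, h⟩
    obtain ⟨i, hi⟩ := this
    obtain ⟨a, b, ha, hb, e⟩ := hi.exists_eq_swap (hτ i)
    refine ⟨fun x y => ?_⟩
    obtain ⟨k, hk⟩ := hσ.sameCycle_join ha hb x y
    rw [← e] at hk
    have h1 : τ i ∈ Subgroup.closure ({σ, s} ∪ Set.range τ : Set (Perm (Fin d))) :=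
      Subgroup.subset_closure (Or.inr ⟨i, rfl⟩)
    have h2 : σ ∈ Subgroup.closure ({σ, s} ∪ Set.range τ : Set (Perm (Fin d))) :=
      Subgroup.subset_closure (Or.inl (Or.inl rfl))
    exact ⟨⟨(τ i * σ) ^ k, zpow_mem (mul_mem h1 h2) k⟩, hk⟩

theorem isOrbitListing_inv {n : ℕ} {ρ : Perm (Fin d)} {ν : Fin n → ℕ} {B : Fin n → Set (Fin d)} :
    IsOrbitListing ρ⁻¹ ν B ↔ IsOrbitListing ρ ν B := by
  simp only [IsOrbitListing, sameCycle_inv]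

theorem monCond_two_zero {τ : Fin 2 → Perm (Fin d)} :
    MonCond 2 0 τ ↔ permTop (τ 0) ≤ permTop (τ 1) := by
  constructor
  · intro h
    exact (h 0 1 rfl).1 (by simp)
  · intro h i j hij
    have hi : i = 0 := by omega
    have hj : j = 1 := by omega
    subst hi hj
    exact ⟨fun _ => h, fun h' => by simp at h'⟩

theorem HasTwoBlocks.tuple_iff {σ s : Perm (Fin d)} (hσ : HasTwoBlocks σ m) (h0 : 0 < m)
    (hm : m < d) {ν : Fin 2 → ℕ} {τ : Fin 2 → Perm (Fin d)} {B : Fin 2 → Set (Fin d)} :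
    ((∀ i, (τ i).IsSwap) ∧ MonCond 2 0 τ ∧ s * (List.ofFn τ).reverse.prod * σ = 1 ∧
      MulAction.IsPretransitive
        (Subgroup.closure ({σ, s} ∪ Set.range τ : Set (Perm (Fin d)))) (Fin d) ∧
      IsOrbitListing s ν B) ↔
    s = (τ 1 * (τ 0 * σ))⁻¹ ∧ (τ 0, τ 1, B) ∈ monotoneTriples σ m ν := by
  have hprod : s * (List.ofFn τ).reverse.prod * σ = 1 ↔ s = (τ 1 * (τ 0 * σ))⁻¹ := by
    rw [← mul_eq_one_iff_eq_inv]
    simp [List.ofFn_succ, mul_assoc]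
  rw [hprod, monCond_two_zero]
  constructor
  · rintro ⟨h1, h2, h3, h4, h5⟩
    refine ⟨h3, h1 0, h1 1, h2, (hσ.isPretransitive_iff h0 hm h1 h3).1 h4, ?_⟩
    rwa [h3, isOrbitListing_inv] at h5
  · rintro ⟨h3, h1, h1', h2, h4, h5⟩
    have h : ∀ i, (τ i).IsSwap := by
      intro i
      fin_cases i
      · exact h1
      · exact h1'
    refine ⟨h, h2, h3, (hσ.isPretransitive_iff h0 hm h h3).2 h4, ?_⟩
    rwa [h3, isOrbitListing_inv]

theorem HasTwoBlocks.natCard_tuples {σ : Perm (Fin d)} (hσ : HasTwoBlocks σ m) (h0 : 0 < m)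
    (hm : m < d) (ν : Fin 2 → ℕ) :
    Nat.card {t : (Fin 2 → Perm (Fin d)) × Perm (Fin d) × (Fin 2 → Set (Fin d)) //
      (∀ i, (t.1 i).IsSwap) ∧ MonCond 2 0 t.1 ∧
      t.2.1 * (List.ofFn t.1).reverse.prod * σ = 1 ∧
      MulAction.IsPretransitive
        (Subgroup.closure ({σ, t.2.1} ∪ Set.range t.1 : Set (Perm (Fin d)))) (Fin d) ∧
      IsOrbitListing t.2.1 ν t.2.2} = (monotoneTriples σ m ν).ncard := by
  rw [← Nat.card_coe_set_eq]
  refine Nat.card_congr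
    { toFun := fun t => ⟨(t.1.1 0, t.1.1 1, t.1.2.2), ((hσ.tuple_iff h0 hm).1 t.2).2⟩
      invFun := fun t => ⟨(![t.1.1, t.1.2.1], (t.1.2.1 * (t.1.1 * σ))⁻¹, t.1.2.2),
        (hσ.tuple_iff h0 hm).2 ⟨rfl, t.2⟩⟩
      left_inv := ?_
      right_inv := fun t => rfl }
  rintro ⟨⟨τ, s, B⟩, h⟩
  have hs := ((hσ.tuple_iff h0 hm).1 h).1
  refine Subtype.ext (Prod.ext ?_ (Prod.ext hs.symm rfl))
  funext i
  fin_cases i <;> rfl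

theorem sameCycle_finRotate (n : ℕ) (i j : Fin n) : (finRotate n).SameCycle i j := by
  obtain _ | _ | n := n
  · exact i.elim0
  · exact (Subsingleton.elim (α := Fin 1) i j).sameCycle _
  · have h : ∀ i : Fin (n + 2), finRotate (n + 2) i ≠ i := fun i => by
      rw [finRotate_apply]; simp
    exact isCycle_finRotate.sameCycle (h i) (h j)

theorem blockPerm_zpow_apply {n : ℕ} (μ : Fin n → ℕ) (k : ℤ) (i : Fin n) (u : Fin (μ i)) :
    (blockPerm μ ^ k) (finSigmaFinEquiv ⟨i, u⟩) =
      finSigmaFinEquiv ⟨i, (finRotate (μ i) ^ k) u⟩ := by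
  have h1 : ∀ (i : Fin n) (u : Fin (μ i)), blockPerm μ (finSigmaFinEquiv ⟨i, u⟩) =
      finSigmaFinEquiv ⟨i, finRotate (μ i) u⟩ := fun i u => by
    simp [blockPerm, Equiv.permCongr_apply]
  have h2 : ∀ (i : Fin n) (u : Fin (μ i)), (blockPerm μ)⁻¹ (finSigmaFinEquiv ⟨i, u⟩) =
      finSigmaFinEquiv ⟨i, (finRotate (μ i))⁻¹ u⟩ := fun i u => by
    rw [Perm.inv_eq_iff_eq, h1]
    exact congrArg (fun v => finSigmaFinEquiv ⟨i, v⟩) ((finRotate (μ i)).apply_symm_apply u).symm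
  induction k generalizing u with
  | zero => simp
  | succ k ih => rw [zpow_add_one, zpow_add_one, Perm.mul_apply, Perm.mul_apply, h1, ih]
  | pred k ih => rw [zpow_sub_one, zpow_sub_one, Perm.mul_apply, Perm.mul_apply, h2, ih]

theorem sameCycle_blockPerm_iff {n : ℕ} (μ : Fin n → ℕ) (p q : (i : Fin n) × Fin (μ i)) :
    (blockPerm μ).SameCycle (finSigmaFinEquiv p) (finSigmaFinEquiv q) ↔ p.1 = q.1 := by
  obtain ⟨i, u⟩ := p
  obtain ⟨j, v⟩ := q
  constructor
  · rintro ⟨k, hk⟩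
    rw [blockPerm_zpow_apply] at hk
    have h := finSigmaFinEquiv.injective hk
    exact (Sigma.mk.inj h).1
  · rintro (rfl : i = j)
    obtain ⟨k, hk⟩ := sameCycle_finRotate _ u v
    exact ⟨k, by rw [blockPerm_zpow_apply, hk]⟩

theorem hasTwoBlocks_blockPerm (μ₁ μ₂ : ℕ) : HasTwoBlocks (blockPerm ![μ₁, μ₂]) μ₁ := by
  have hlt : ∀ p : (i : Fin 2) × Fin (![μ₁, μ₂] i),
      (finSigmaFinEquiv p : ℕ) < μ₁ ↔ p.1 = 0 := by
    rintro ⟨i, u⟩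
    rw [finSigmaFinEquiv_apply]
    fin_cases i
    · simpa using u.2
    · simp
  intro x y
  obtain ⟨p, rfl⟩ := finSigmaFinEquiv.surjective x
  obtain ⟨q, rfl⟩ := finSigmaFinEquiv.surjective y
  rw [sameCycle_blockPerm_iff, hlt, hlt]
  omega

end Reduction

/-- In the chamber `ν₁ < μ₁, ν₂ < μ₁, μ₂ < ν₁, μ₂ < ν₂`, the count
`M_{2,0,0;(μ₁,μ₂),(ν₁,ν₂)}` (two transpositions with `top τ₁ ≤ top τ₂`) equals
`μ₁·μ₂·(μ₁+1)`. -/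
theorem strictly_monotone_count_chamberOne
    (μ₁ μ₂ ν₁ ν₂ : ℕ)
    (hμ₁ : 0 < μ₁) (hμ₂ : 0 < μ₂) (hν₁ : 0 < ν₁) (hν₂ : 0 < ν₂)
    (hd : μ₁ + μ₂ = ν₁ + ν₂)
    (c1 : ν₁ < μ₁) (c2 : ν₂ < μ₁) (c3 : μ₂ < ν₁) (c4 : μ₂ < ν₂) :
    Mcount 2 0 0 ![μ₁, μ₂] ![ν₁, ν₂] = μ₁ * μ₂ * (μ₁ + 1) := by
  have hσ := hasTwoBlocks_blockPerm μ₁ μ₂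
  have hsum : ∑ i, ![μ₁, μ₂] i = μ₁ + μ₂ := by simp
  have hsub : ∑ i, ![μ₁, μ₂] i - μ₁ = μ₂ := by omega
  have hlt : ∀ j, ∑ i, ![μ₁, μ₂] i - μ₁ < ![ν₁, ν₂] j := by
    intro j
    rw [hsub]
    fin_cases j
    · exact c3
    · exact c4
  have h1 : Mcount 2 0 0 ![μ₁, μ₂] ![ν₁, ν₂] =
      (monotoneTriples (blockPerm ![μ₁, μ₂]) μ₁ ![ν₁, ν₂]).ncard :=
    hσ.natCard_tuples hμ₁ (by omega) _
  rw [h1, hσ.ncard_monotoneTriples (by omega) (by rw [hsum]; exact hd.symm) hlt c1.le, hsub]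
  simp only [Matrix.cons_val_zero, Matrix.cons_val_one]
  obtain ⟨e, rfl⟩ := Nat.exists_eq_add_of_lt c1
  have e2 : ν₁ + e + 1 - ν₁ = e + 1 := by omega
  obtain rfl : ν₂ = e + 1 + μ₂ := by omega
  have e3 : ν₁ + e + 1 - (e + 1 + μ₂) = ν₁ - μ₂ := by omega
  obtain ⟨f, rfl⟩ := Nat.exists_eq_add_of_lt c3
  have e4 : μ₂ + f + 1 - μ₂ = f + 1 := by omega
  rw [e2, e3, e4]
  ring
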